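/- Let x ∈ A^ℤ be a Toeplitz sequence with single holes with respect to a period structure (p_n)_{n≥0}, and let X be the Toeplitz subshift generated by x. Then (X,S) is conjugate to (X,S^{−1}) if and only if there exist n ∈ ℕ and a permutation θ of A such that for every m > n the (n,m)-filling of x is a θ-palindrome. -/

import Mathlib

namespace ToeplitzFR

open Set

variable {A B C : Type*}

/-- The shift map `S` on `ℤ → A`: `S(x)(i) = x(i+1)`. -/
def shift (x : ℤ → A) : ℤ → A := fun i => x (i + 1)

/-- The inverse shift map `S⁻¹`. -/
def shiftInv (x : ℤ → A) : ℤ → A := fun i => x (i - 1)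

/-- The shift by `k`: `S^k`. -/
def shiftBy (k : ℤ) (x : ℤ → A) : ℤ → A := fun i => x (i + k)

/-- The finite word `x[i, i+n)`. -/
def factorAt (x : ℤ → A) (i : ℤ) (n : ℕ) : List A :=
  (List.range n).map fun j => x (i + j)

/-- `x` is a periodic point of the shift. -/
def IsPeriodicPoint (x : ℤ → A) : Prop := ∃ p : ℕ, 0 < p ∧ ∀ i : ℤ, x (i + p) = x i

def IsAperiodicPoint (x : ℤ → A) : Prop := ¬ IsPeriodicPoint x

/-- `Per_p(x)`. -/
def PerSet (x : ℤ → A) (p : ℕ) : Set ℤ := {i : ℤ | ∀ k : ℤ, x (i + k * p) = x i}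

/-- `Per(x) = ⋃_{p>1} Per_p(x)`. -/
def PerAll (x : ℤ → A) : Set ℤ := {i : ℤ | ∃ p : ℕ, 1 < p ∧ i ∈ PerSet x p}

/-- `x` is a Toeplitz sequence. -/
def IsToeplitz (x : ℤ → A) : Prop := ∀ i : ℤ, ∃ p : ℕ, 1 < p ∧ i ∈ PerSet x p

/-- The shift orbit of `x`. -/
def orbit (x : ℤ → A) : Set (ℤ → A) := {y | ∃ k : ℤ, y = shiftBy k x}

/-- `X` is the Toeplitz subshift generated by the Toeplitz sequence `x`. -/
def ToeplitzGenerates [TopologicalSpace A] (x : ℤ → A) (X : Set (ℤ → A)) : Prop :=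
  IsToeplitz x ∧ X = closure (orbit x)

/-- `X` is a Toeplitz subshift. -/
def IsToeplitzSubshift [TopologicalSpace A] (X : Set (ℤ → A)) : Prop :=
  ∃ x : ℤ → A, ToeplitzGenerates x X

/-- The `p`-skeleton of `x`, with `none` as the blank symbol. -/
noncomputable def Skel (x : ℤ → A) (p : ℕ) : ℤ → Option A :=
  fun i => @ite _ (i ∈ PerSet x p) (Classical.dec _) (some (x i)) none

/-- `p` is an essential period of `x`. -/
def IsEssentialPeriod (x : ℤ → A) (p : ℕ) : Prop :=
  1 < p ∧ ∀ q : ℕ, 0 < q → q < p → ∃ i : ℤ, Skel x p (i + q) ≠ Skel x p i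

/-- `(P n)` is a period structure for `x`. -/
def IsPeriodStructure (x : ℤ → A) (P : ℕ → ℕ) : Prop :=
  StrictMono P ∧ (∀ n, IsEssentialPeriod x (P n)) ∧ (∀ n, P n ∣ P (n+1)) ∧
    ∀ i : ℤ, ∃ n, i ∈ PerSet x (P n)

/-- `q` divides the scale of the Toeplitz subshift `X`. -/
def DividesScale [TopologicalSpace A] (X : Set (ℤ → A)) (q : ℕ) : Prop :=
  ∃ (x : ℤ → A) (P : ℕ → ℕ),
    ToeplitzGenerates x X ∧ IsPeriodStructure x P ∧ ∃ n, q ∣ P n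

/-! ### Directive sequences and S-adic subshifts -/

/-- All morphisms in the directive sequence are non-erasing. -/
def NonErasing {A : ℕ → Type*} (τ : ∀ n, A (n+1) → List (A n)) : Prop :=
  ∀ n a, τ n a ≠ []

/-- The directive sequence has constant length. -/
def ConstantLength {A : ℕ → Type*} (τ : ∀ n, A (n+1) → List (A n)) : Prop :=
  ∀ n, ∀ a b : A (n+1), (τ n a).length = (τ n b).length

/-- The directive sequence is proper. -/
def ProperSeq {A : ℕ → Type*} (τ : ∀ n, A (n+1) → List (A n)) : Prop :=
  ∀ n, ∃ b c : A n, ∀ a : A (n+1), (τ n a).head? = some b ∧ (τ n a).getLast? = some c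

/-- `sadicWordAux τ n k a = τ_{[n, n+k)}(a)`. -/
def sadicWordAux {A : ℕ → Type*} (τ : ∀ n, A (n+1) → List (A n)) (n : ℕ) :
    ∀ k : ℕ, A (n + k) → List (A n)
  | 0, a => [a]
  | (k+1), a => (τ (n+k) a).flatMap (sadicWordAux τ n k)

/-- `word0 τ k a = τ_{[0, k)}(a)` for `a ∈ A k`. -/
def word0 {A : ℕ → Type*} (τ : ∀ n, A (n+1) → List (A n)) :
    ∀ k : ℕ, A k → List (A 0)
  | 0, a => [a]
  | (k+1), a => (τ k a).flatMap (word0 τ k)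

/-- The directive sequence is primitive. -/
def PrimitiveSeq {A : ℕ → Type*} (τ : ∀ n, A (n+1) → List (A n)) : Prop :=
  ∀ n, ∃ k : ℕ, 0 < k ∧ ∀ (a : A (n+k)) (b : A n), b ∈ sadicWordAux τ n k a

/-- The `n`-th level `X_τ^{(n)}` of the S-adic system generated by `τ`. -/
def XLevel {A : ℕ → Type*} (τ : ∀ n, A (n+1) → List (A n)) (n : ℕ) :
    Set (ℤ → A n) :=
  {y | ∀ (i : ℤ) (m : ℕ), ∃ k : ℕ, 0 < k ∧ ∃ a : A (n+k),
      (factorAt y i m).IsInfix (sadicWordAux τ n k a)}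

/-- The alphabet rank (`liminf_n |A_n|`) is at most `K`. -/
def AlphabetRankLE (A : ℕ → Type*) [∀ n, Fintype (A n)] (K : ℕ) : Prop :=
  ∀ N : ℕ, ∃ n, N ≤ n ∧ Fintype.card (A n) ≤ K

/-! ### Recognizability -/

/-- `z` is the bi-infinite concatenation `⋯σ(y(-1)).σ(y(0))σ(y(1))⋯`,
with `σ(y(0))` starting at coordinate `0`. -/
def IsConcat (σ : B → List C) (y : ℤ → B) (z : ℤ → C) : Prop :=
  ∃ c : ℤ → ℤ, c 0 = 0 ∧ (∀ j : ℤ, c (j + 1) = c j + (σ (y j)).length) ∧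
    ∀ (j : ℤ) (m : Fin (σ (y j)).length), z (c j + (m : ℕ)) = (σ (y j)).get m

/-- `(y, k)` is a centered `σ`-representation of `x` in `Y`. -/
def IsCenteredRep (σ : B → List C) (Y : Set (ℤ → B)) (x : ℤ → C)
    (y : ℤ → B) (k : ℕ) : Prop :=
  y ∈ Y ∧ k < (σ (y 0)).length ∧ IsConcat σ y (fun m => x (m - k))

/-- The morphism `σ` is recognizable in `Y`. -/
def RecognizableIn (σ : B → List C) (Y : Set (ℤ → B)) : Prop :=
  ∀ (x : ℤ → C) (y y' : ℤ → B) (k k' : ℕ),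
    IsCenteredRep σ Y x y k → IsCenteredRep σ Y x y' k' → y = y' ∧ k = k'

/-- The directive sequence `τ` is recognizable. -/
def RecognizableSeq {A : ℕ → Type*} (τ : ∀ n, A (n+1) → List (A n)) : Prop :=
  ∀ n, RecognizableIn (τ n) (XLevel τ (n+1))

/-! ### Conjugacy -/

/-- `(X, TX)` and `(Y, TY)` are conjugate via a homeomorphism. -/
def ConjugateBy [TopologicalSpace A] [TopologicalSpace B]
    (X : Set (ℤ → A)) (Y : Set (ℤ → B))
    (TX : (ℤ → A) → (ℤ → A)) (TY : (ℤ → B) → (ℤ → B)) : Prop :=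
  ∃ φ : ↥X ≃ₜ ↥Y, ∀ (x : ℤ → A) (hx : x ∈ X) (hx' : TX x ∈ X),
    (φ ⟨TX x, hx'⟩).1 = TY (φ ⟨x, hx⟩).1

/-- `(X, S)` and `(Y, S)` are conjugate subshifts. -/
def Conjugate [TopologicalSpace A] [TopologicalSpace B]
    (X : Set (ℤ → A)) (Y : Set (ℤ → B)) : Prop :=
  ConjugateBy X Y shift shift

/-- `X` is a strong Toeplitz subshift of rank `K`: it is conjugate to the S-adic subshift
of a constant-length, primitive, proper and recognizable directive sequence of
alphabet rank at most `K`. -/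
def IsStrongToeplitzOfRank [TopologicalSpace A] (X : Set (ℤ → A)) (K : ℕ) : Prop :=
  ∃ (B : ℕ → Type) (iB : ∀ n, Fintype (B n)) (σ : ∀ n, B (n+1) → List (B n)),
    NonErasing σ ∧ ConstantLength σ ∧ PrimitiveSeq σ ∧ ProperSeq σ ∧
    RecognizableSeq σ ∧ @AlphabetRankLE B iB K ∧
    @Conjugate A (B 0) _ ⊥ X (XLevel σ 0)

/-- `X` is conjugate to the S-adic subshift of a primitive, proper and recognizable
directive sequence of alphabet rank at most `K`. -/
def HasFiniteRankSAdicRep [TopologicalSpace A] (X : Set (ℤ → A)) (K : ℕ) : Prop :=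
  ∃ (B : ℕ → Type) (iB : ∀ n, Fintype (B n)) (σ : ∀ n, B (n+1) → List (B n)),
    NonErasing σ ∧ PrimitiveSeq σ ∧ ProperSeq σ ∧
    RecognizableSeq σ ∧ @AlphabetRankLE B iB K ∧
    @Conjugate A (B 0) _ ⊥ X (XLevel σ 0)

/-! ### Cuts, languages, built-from -/

/-- The set of words `{x[t+kp, t+(k+1)p) : k ∈ ℤ}`. -/
def cutWords (x : ℤ → A) (p t : ℕ) : Set (List A) :=
  {w | ∃ k : ℤ, w = factorAt x ((t : ℤ) + k * p) p}

/-- `(p, t)` is a strong rank-2 cut of `x`. -/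
def StrongRank2Cut (x : ℤ → A) (p t : ℕ) : Prop :=
  t < p ∧ ∃ u v : List A, u ≠ v ∧ cutWords x p t = {u, v}

/-- The language `L_n(X)`. -/
def Lang (n : ℕ) (X : Set (ℤ → A)) : Set (List A) :=
  {w | ∃ x ∈ X, ∃ i : ℤ, w = factorAt x i n}

/-- The maximal common prefix of `u` and `v` has length greater than `m`. -/
def CommonPrefixLongerThan (u v : List A) (m : ℕ) : Prop :=
  m + 1 ≤ u.length ∧ m + 1 ≤ v.length ∧ u.take (m+1) = v.take (m+1)

/-- The maximal common suffix of `u` and `v` has length greater than `m`. -/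
def CommonSuffixLongerThan (u v : List A) (m : ℕ) : Prop :=
  CommonPrefixLongerThan u.reverse v.reverse m

/-- `b = (β₀, (α₁, …, α_k), β₁)` is a building of the word `w` from `W`:
`w = β₀α₁⋯α_kβ₁`, all `αᵢ ∈ W`, `β₀` is a proper suffix of an element of `W`,
and `β₁` is a proper prefix of an element of `W`. -/
def IsBuilding (W : Set (List A)) (w : List A)
    (b : List A × List (List A) × List A) : Prop :=
  w = b.1 ++ b.2.1.flatten ++ b.2.2 ∧ (∀ α ∈ b.2.1, α ∈ W) ∧
  (∃ u ∈ W, b.1 <:+ u ∧ b.1 ≠ u) ∧ (∃ u ∈ W, b.2.2 <+: u ∧ b.2.2 ≠ u)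

/-- `w` is uniquely built from `W`. -/
def UniquelyBuiltFrom (W : Set (List A)) (w : List A) : Prop :=
  ∃! b : List A × List (List A) × List A, IsBuilding W w b

/-- `X` together with one of its points satisfies the strong rank-2 cut property. -/
def GoodCuts [TopologicalSpace A] (X : Set (ℤ → A)) (x : ℤ → A) : Prop :=
  ∀ p : ℕ, 0 < p → DividesScale X p → ∀ m : ℕ,
    ∃ q t : ℕ, StrongRank2Cut x q t ∧ p ∣ q ∧ DividesScale X q ∧
      ∃ u v : List A, u ≠ v ∧ cutWords x q t = {u, v} ∧
        CommonPrefixLongerThan u v m ∧ CommonSuffixLongerThan u v m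

/-! ### Euclidean pairs and buildings of bi-infinite sequences -/

/-- `{u, v}` is a Euclidean pair. -/
def EuclideanPair (u v : List A) : Prop :=
  ∃ (w : List A) (k l : ℕ),
    u = (List.replicate k w).flatten ∧ v = (List.replicate l w).flatten

/-- `α` is the distinguished prefix of `u` and `v`. -/
def IsDistinguishedPrefix (u v α : List A) : Prop :=
  α.length < u.length + v.length ∧
  ∀ x y : List A,
    (∃ l : List (List A), (∀ w ∈ l, w = u ∨ w = v) ∧ x = u ++ l.flatten) →
    (∃ l : List (List A), (∀ w ∈ l, w = u ∨ w = v) ∧ y = v ++ l.flatten) →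
    α.length + 1 ≤ x.length → α.length + 1 ≤ y.length →
    α <+: x ∧ α <+: y ∧ x[α.length]? ≠ y[α.length]?

/-- `β` is the distinguished suffix of `u` and `v`. -/
def IsDistinguishedSuffix (u v β : List A) : Prop :=
  IsDistinguishedPrefix u.reverse v.reverse β.reverse

/-- `(c, f)` is a building of the bi-infinite sequence `x` from `W`:
block `j` starts at position `c j` and carries the word `f j ∈ W`. -/
def IsBuildingSeq (W : Set (List A)) (x : ℤ → A) (c : ℤ → ℤ) (f : ℤ → List A) : Prop :=
  (∀ j : ℤ, f j ∈ W) ∧ (∀ j : ℤ, c (j + 1) = c j + (f j).length) ∧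
  ∀ (j : ℤ) (m : Fin (f j).length), x (c j + (m : ℕ)) = (f j).get m

/-- The subshift `X_{u,v}` of all sequences built from `{u, v}`. -/
def Xuv (u v : List A) : Set (ℤ → A) :=
  {x | ∃ (c : ℤ → ℤ) (f : ℤ → List A), IsBuildingSeq {u, v} x c f}

/-! ### Block-code conjugacies -/

/-- A conjugacy `φ : X → Y` admitting block width `2n+1`. -/
structure BlockConjugacy (A : Type*) (X Y : Set (ℤ → A)) (n : ℕ) where
  toFun : (ℤ → A) → (ℤ → A)
  invFun : (ℤ → A) → (ℤ → A)
  maps_to : ∀ x ∈ X, toFun x ∈ Y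
  maps_from : ∀ y ∈ Y, invFun y ∈ X
  left_inv : ∀ x ∈ X, invFun (toFun x) = x
  right_inv : ∀ y ∈ Y, toFun (invFun y) = y
  shift_comm : ∀ x ∈ X, toFun (shift x) = shift (toFun x)
  code : List A → A
  code_inv : List A → A
  code_spec : ∀ x ∈ X, ∀ i : ℤ, toFun x i = code (factorAt x (i - n) (2*n+1))
  code_inv_spec : ∀ y ∈ Y, ∀ i : ℤ, invFun y i = code_inv (factorAt y (i - n) (2*n+1))

/-! ### Parts, permutation action, χ -/

/-- `W` is a member of `Parts(X, p)`: a class of the common-`p`-skeleton relation. -/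
def SkelClass (X : Set (ℤ → A)) (p : ℕ) (W : Set (ℤ → A)) : Prop :=
  ∃ y ∈ X, W = {z ∈ X | Skel z p = Skel y p}

/-- The map `ψ̂` induced by a permutation `ψ` of `A^p`. -/
def permHat (p : ℕ) (ψ : Equiv.Perm (Fin p → A)) (x : ℤ → A) : ℤ → A :=
  fun i =>
    if h : (i.emod p).toNat < p then
      ψ (fun m : Fin p => x (i - i.emod p + (m : ℕ))) ⟨(i.emod p).toNat, h⟩
    else x i

/-- The relation `E_p` on compact subsets of `A^ℤ`. -/
def EpRel (p : ℕ) (K L : Set (ℤ → A)) : Prop :=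
  ∃ ψ : Equiv.Perm (Fin p → A), L = permHat p ψ '' K

/-- `W ∈ Parts_*(X, p)`. -/
def SkelClassStar (X : Set (ℤ → A)) (p : ℕ) (W : Set (ℤ → A)) : Prop :=
  SkelClass X p W ∧ ∀ y ∈ W, Skel y p (-1) = none ∧ Skel y p 0 ≠ none

/-- `length(W) = L` for `W ∈ Parts_*(X, p)`. -/
def HasLength (p : ℕ) (W : Set (ℤ → A)) (L : ℕ) : Prop :=
  ∀ y ∈ W, (∀ i : ℕ, i < L → Skel y p (i : ℤ) ≠ none) ∧ Skel y p (L : ℤ) = none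

/-- `Z ∈ χ(X, p)`. -/
def ChiMem (X : Set (ℤ → A)) (p : ℕ) (Z : Set (ℤ → A)) : Prop :=
  ∃ (W : Set (ℤ → A)) (L : ℕ), SkelClassStar X p W ∧ HasLength p W L ∧
    (∀ (W' : Set (ℤ → A)) (L' : ℕ),
      SkelClassStar X p W' → HasLength p W' L' → L' ≤ L) ∧
    Z = shiftBy ((L / 2 : ℕ) : ℤ) '' W

/-- `χ(X, p) E_p^fin χ(Y, p)`. -/
def ChiEpFin (X Y : Set (ℤ → A)) (p : ℕ) : Prop :=
  (∀ K, ChiMem X p K → ∃ L, ChiMem Y p L ∧ EpRel p K L) ∧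
  (∀ L, ChiMem Y p L → ∃ K, ChiMem X p K ∧ EpRel p K L)

/-! ### Single holes and fillings -/

/-- The Toeplitz sequence `x` has single holes with respect to the period structure `P`. -/
def SingleHoles (x : ℤ → A) (P : ℕ → ℕ) : Prop :=
  IsPeriodStructure x P ∧
  ∀ n, ∃! i : ℤ, 0 ≤ i ∧ i < (P n : ℤ) ∧ i ∉ PerSet x (P n)

/-- The Toeplitz subshift `X` has single holes. -/
def HasSingleHoles [TopologicalSpace A] (X : Set (ℤ → A)) : Prop :=
  ∃ (x : ℤ → A) (P : ℕ → ℕ), ToeplitzGenerates x X ∧ SingleHoles x P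

/-- `w` is the `(n, m)`-filling of `x` (for periods `pn < pm`). -/
def IsFilling (x : ℤ → A) (pn pm : ℕ) (w : List A) : Prop :=
  w.length = pm / pn - 1 ∧
  ∀ h : ℤ, 0 ≤ h → h < (pm : ℤ) → h ∉ PerSet x pm →
    ∀ (j : ℕ) (hj : j < w.length), w.get ⟨j, hj⟩ = x (h + (j+1) * pn)

/-- `u` is a `θ`-palindrome. -/
def ThetaPalindrome (θ : Equiv.Perm A) (u : List A) : Prop :=
  u.map (fun a => θ a) = u.reverse

/-! ### Nice symmetries -/

/-- `x` has nice symmetries with respect to `(p, q)`. -/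
def NiceSymmetries (x : ℤ → A) (p q : ℕ) : Prop :=
  ∃ m : ℤ, 1 < m ∧ m ≤ (q : ℤ) + 1 ∧
    (∀ k : ℕ, k < q / p →
      (Set.Ico ((k * p : ℕ) : ℤ) (((k+1) * p : ℕ) : ℤ) ⊆ PerSet x q ↔
       Set.Ico (m - ((k+1) * p : ℕ)) (m - (k * p : ℕ)) ⊆ PerSet x q)) ∧
    (∀ k k' : ℕ, k < q / p → k' < q / p →
      Set.Ico ((k * p : ℕ) : ℤ) (((k+1) * p : ℕ) : ℤ) ⊆ PerSet x q →
      Set.Ico ((k' * p : ℕ) : ℤ) (((k'+1) * p : ℕ) : ℤ) ⊆ PerSet x q →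
      (factorAt x ((k * p : ℕ) : ℤ) p = factorAt x ((k' * p : ℕ) : ℤ) p ↔
       factorAt x (m - ((k+1) * p : ℕ)) p = factorAt x (m - ((k'+1) * p : ℕ)) p))

/-- For some `p` dividing the scale of `X`, `x` has nice symmetries with respect to
`(p, q)` for all `q > p` with `p ∣ q` dividing the scale of `X`. -/
def NiceSymAll [TopologicalSpace A] (X : Set (ℤ → A)) (x : ℤ → A) : Prop :=
  ∃ p : ℕ, 0 < p ∧ DividesScale X p ∧
    ∀ q : ℕ, p < q → p ∣ q → DividesScale X q → NiceSymmetries x p q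

/-- A pair `(x, x')` is a centered left asymptotic pair. -/
def CenteredLeftAsymptoticPair (x x' : ℤ → A) : Prop :=
  (∀ i : ℤ, i < 0 → x i = x' i) ∧ x 0 ≠ x' 0

/-! ### Automorphism groups -/

/-- `e` is an automorphism of the subshift `(X, S)`. -/
def IsShiftAutomorphism [TopologicalSpace A] (X : Set (ℤ → A)) (e : ↥X ≃ₜ ↥X) : Prop :=
  ∀ (x : ℤ → A) (hx : x ∈ X) (hx' : shift x ∈ X),
    (e ⟨shift x, hx'⟩).1 = shift (e ⟨x, hx⟩).1

/-- The automorphism group of `(X, S)` is isomorphic, as a group, to `ℤ × ℤ/nℤ`. -/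
def AutGroupIsoZxZmod [TopologicalSpace A] (X : Set (ℤ → A)) (n : ℕ) : Prop :=
  ∃ Φ : {e : ↥X ≃ₜ ↥X // IsShiftAutomorphism X e} → ℤ × ZMod n,
    Function.Bijective Φ ∧
    ∀ e f g : {e : ↥X ≃ₜ ↥X // IsShiftAutomorphism X e},
      (∀ z : ↥X, g.1 z = e.1 (f.1 z)) → Φ g = Φ e + Φ f

/-! ### The Polish space of subshifts over `ℤ` -/

/-- A point of the space `𝐒` of all (compact, nonempty, shift-invariant) subshifts
over finite alphabets contained in `ℤ`. -/
structure SubshiftSpace : Type where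
  carrier : Set (ℤ → ℤ)
  nonempty : carrier.Nonempty
  compact : IsCompact carrier
  invariant : shift '' carrier = carrier

/-- The topology on `𝐒` induced by the languages `(L_n(X))_{n}`, with each
family of `n`-languages discrete; this coincides with the metric
`d(X,Y) = 2^{-min{n : L_n(X) ≠ L_n(Y)}}`. -/
instance : TopologicalSpace SubshiftSpace :=
  TopologicalSpace.induced
    (fun X : SubshiftSpace => (fun n => Lang n X.carrier : ℕ → Set (List ℤ)))
    (@Pi.topologicalSpace ℕ (fun _ => Set (List ℤ)) (fun _ => ⊥))

/-- The subset `𝐌 ⊆ 𝐒` of infinite minimal subshifts. -/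
def MinimalSet : Set SubshiftSpace :=
  {X | X.carrier.Infinite ∧ ∀ x ∈ X.carrier, X.carrier ⊆ closure (orbit x)}



section Proof18

open Topology

variable {A : Type*}

lemma per_eq {x : ℤ → A} {p : ℕ} {i j : ℤ} (hi : i ∈ PerSet x p) (h : (p : ℤ) ∣ i - j) :
    x i = x j := by
  obtain ⟨k, hk⟩ := h
  have := hi (-k)
  rw [← this]
  congr 1
  linarith

lemma per_congr {x : ℤ → A} {p : ℕ} {i j : ℤ} (h : (p : ℤ) ∣ i - j) (hi : i ∈ PerSet x p) :
    j ∈ PerSet x p := by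
  intro k
  rw [← per_eq hi h]
  symm
  apply per_eq hi
  obtain ⟨l, hl⟩ := h
  exact ⟨l - k, by linarith⟩

lemma per_mono {x : ℤ → A} {p q : ℕ} {i : ℤ} (h : p ∣ q) (hi : i ∈ PerSet x p) :
    i ∈ PerSet x q := by
  intro k
  symm
  apply per_eq hi
  obtain ⟨l, rfl⟩ := h
  exact ⟨- k * l, by push_cast; ring⟩

lemma hole_exists {x : ℤ → A} {P : ℕ → ℕ} (hs : SingleHoles x P) (n : ℕ) :
    ∃ h : ℤ, 0 ≤ h ∧ h < P n ∧ h ∉ PerSet x (P n) := (hs.2 n).exists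

lemma P_pos {x : ℤ → A} {P : ℕ → ℕ} (hs : SingleHoles x P) (n : ℕ) : (0 : ℤ) < P n := by
  have := (hs.1.2.1 n).1
  omega

lemma P_dvd {x : ℤ → A} {P : ℕ → ℕ} (hs : SingleHoles x P) {n m : ℕ} (h : n ≤ m) :
    P n ∣ P m := by
  induction m, h using Nat.le_induction with
  | base => exact dvd_rfl
  | succ m _ ih => exact ih.trans (hs.1.2.2.1 m)

lemma hole_iff {x : ℤ → A} {P : ℕ → ℕ} (hs : SingleHoles x P) {n : ℕ} {g : ℤ}
    (hg : g ∉ PerSet x (P n)) (i : ℤ) : i ∉ PerSet x (P n) ↔ (P n : ℤ) ∣ i - g := by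
  have hp := P_pos hs n
  constructor
  · intro hi
    have key : ∀ j : ℤ, j ∉ PerSet x (P n) → j % (P n) ∉ PerSet x (P n) := fun j hj hj' =>
      hj (per_congr (by rw [dvd_sub_comm]; exact Int.dvd_self_sub_emod) hj')
    have := (hs.2 n).unique ⟨Int.emod_nonneg i hp.ne', Int.emod_lt_of_pos i hp, key i hi⟩
      ⟨Int.emod_nonneg g hp.ne', Int.emod_lt_of_pos g hp, key g hg⟩
    exact Int.ModEq.dvd (Int.ModEq.symm this)
  · intro h hi
    exact hg (per_congr h hi)

lemma hole_nest {x : ℤ → A} {P : ℕ → ℕ} (hs : SingleHoles x P) {n m : ℕ} (h : n ≤ m) {g : ℤ}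
    (hg : g ∉ PerSet x (P m)) : g ∉ PerSet x (P n) := fun hmem => hg (per_mono (P_dvd hs h) hmem)

/-- strictly between two consecutive holes there are no holes -/
lemma between {x : ℤ → A} {P : ℕ → ℕ} (hs : SingleHoles x P) {n : ℕ} {g r : ℤ}
    (hg : g ∉ PerSet x (P n)) (h0 : r ≠ 0) (h1 : |r| < P n) : g + r ∈ PerSet x (P n) := by
  by_contra hc
  have := (hole_iff hs hg _).1 hc
  rw [add_sub_cancel_left] at this
  exact h0 (Int.eq_zero_of_abs_lt_dvd this h1)

lemma per_all {x : ℤ → A} {P : ℕ → ℕ} (hs : SingleHoles x P) (R : ℕ) (n : ℕ) :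
    ∃ m, n < m ∧ ∀ i : ℤ, |i| ≤ R → i ∈ PerSet x (P m) := by
  choose f hf using hs.1.2.2.2
  refine ⟨n + 1 + (Finset.Icc (-(R : ℤ)) R).sup f, by omega, fun i hi => ?_⟩
  refine per_mono (P_dvd hs ?_) (hf i)
  have : f i ≤ (Finset.Icc (-(R : ℤ)) R).sup f :=
    Finset.le_sup (Finset.mem_Icc.2 (abs_le.1 hi))
  omega

/-- window `[-R,R]` between two consecutive holes -/
lemma window_hole {x : ℤ → A} {P : ℕ → ℕ} (hs : SingleHoles x P) (R : ℕ) (n : ℕ) :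
    ∃ m g, n < m ∧ g ∉ PerSet x (P m) ∧ ∀ i : ℤ, |i| ≤ R → g < i ∧ i < g + P m := by
  obtain ⟨m, hm, hR⟩ := per_all hs R n
  obtain ⟨h, h0, h1, hh⟩ := hole_exists hs m
  have hp := P_pos hs m
  have hhR : (R : ℤ) < h := by
    by_contra hc
    exact hh (hR h (abs_le.2 ⟨by omega, by omega⟩))
  have hg : h - P m ∉ PerSet x (P m) := (hole_iff hs hh _).2 ⟨-1, by ring⟩
  have hhR' : h - P m < - (R : ℤ) := by
    by_contra hc
    exact hg (hR _ (abs_le.2 ⟨by omega, by omega⟩))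
  refine ⟨m, h - P m, hm, hg, fun i hi => ?_⟩
  have := abs_le.1 hi
  constructor <;> omega

/-- functional form of the palindrome condition -/
def Pal (x : ℤ → A) (P : ℕ → ℕ) (n : ℕ) (θ : Equiv.Perm A) : Prop :=
  ∀ m, n < m → ∀ g, g ∉ PerSet x (P m) → ∀ r : ℤ, 0 < r → r < P m → (P n : ℤ) ∣ r →
    θ (x (g + r)) = x (g + P m - r)

lemma pal_iff {x : ℤ → A} {P : ℕ → ℕ} (hs : SingleHoles x P) (n : ℕ) (θ : Equiv.Perm A) :
    Pal x P n θ ↔ ∀ m : ℕ, n < m →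
        ∀ w : List A, IsFilling x (P n) (P m) w → ThetaPalindrome θ w := by
  have hpn := P_pos hs n
  constructor
  · intro H m hm w hw
    obtain ⟨M, hM⟩ := P_dvd hs hm.le
    obtain ⟨h, h0, h1, hh⟩ := hole_exists hs m
    have hpn' : 0 < P n := by exact_mod_cast hpn
    have hlen : w.length = M - 1 := by
      rw [hw.1, hM, Nat.mul_div_cancel_left _ hpn']
    have hw2 := hw.2 h h0 h1 hh
    have hMz : (P m : ℤ) = P n * M := by exact_mod_cast hM
    apply List.ext_get
    · simp
    · intro j hj1 hj2
      simp only [List.length_map] at hj1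
      simp only [List.get_eq_getElem, List.getElem_map, List.getElem_reverse]
      simp only [List.get_eq_getElem] at hw2
      rw [hw2 j hj1, hw2 _ (by omega)]
      rw [H m hm h hh _ (by positivity) ?_ ⟨(j + 1 : ℤ), by ring⟩]
      · congr 1
        have : ((w.length - 1 - j : ℕ) : ℤ) = M - 2 - j := by omega
        rw [this, hMz]; ring
      · rw [hMz, mul_comm]
        apply mul_lt_mul_of_pos_left _ hpn
        omega
  · intro H m hm g hg r hr0 hr1 hr
    obtain ⟨M, hM⟩ := P_dvd hs hm.le
    obtain ⟨h, h0, h1, hh⟩ := hole_exists hs m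
    have hpn' : 0 < P n := by exact_mod_cast hpn
    have hMz : (P m : ℤ) = P n * M := by exact_mod_cast hM
    obtain ⟨q, rfl⟩ := hr
    have hq0 : 0 < q := pos_of_mul_pos_right hr0 hpn.le
    have hq1 : q < M := by rw [hMz] at hr1; exact lt_of_mul_lt_mul_left hr1 hpn.le
    have hgh := (hole_iff hs hh g).1 hg
    have hfill : IsFilling x (P n) (P m)
        (List.ofFn fun j : Fin (M - 1) => x (h + ((j : ℕ) + 1) * P n)) := by
      refine ⟨by simp [hM, Nat.mul_div_cancel_left _ hpn'], ?_⟩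
      intro h' h0' h1' hh' j hj
      have : h' = h := (hs.2 m).unique ⟨h0', h1', hh'⟩ ⟨h0, h1, hh⟩
      subst this
      simp
    have hp := H m hm _ hfill
    unfold ThetaPalindrome at hp
    have hq : q.toNat - 1 < M - 1 := by omega
    have hp' := congrArg (fun l => l[q.toNat - 1]?) hp
    simp only [List.getElem?_map] at hp'
    rw [List.getElem?_reverse (by simpa using hq)] at hp'
    have h2 : M - 1 - 1 - (q.toNat - 1) < M - 1 := by omega
    simp only [List.length_ofFn, List.getElem?_ofFn, hq, h2, dite_true, Option.map_some,
      Option.some.injEq] at hp'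
    have e1 : (((q.toNat - 1 : ℕ) : ℤ) + 1) = q := by omega
    have e2 : (((M - 1 - 1 - (q.toNat - 1) : ℕ) : ℤ) + 1) = M - q := by omega
    rw [e1, e2] at hp'
    have hper : ∀ r : ℤ, 0 < r → r < P m → x (g + r) = x (h + r) := by
      intro r hr0 hr1
      apply per_eq (between hs hg hr0.ne' (by rw [abs_of_pos hr0]; exact hr1))
      simpa using hgh
    rw [hper _ hr0 hr1, mul_comm, hp', add_sub_assoc, hper _ (by linarith) (by linarith)]
    congr 1
    rw [hMz]; ring

section Top
variable [TopologicalSpace A] [DiscreteTopology A]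

lemma mem_closure_orbit {x z : ℤ → A} :
    z ∈ closure (orbit x) ↔ ∀ R : ℕ, ∃ k : ℤ, ∀ i : ℤ, |i| ≤ R → z i = x (i + k) := by
  constructor
  · intro hz R
    have hopen : IsOpen {y : ℤ → A | ∀ i ∈ Finset.Icc (-(R : ℤ)) R, y i = z i} := by
      have : {y : ℤ → A | ∀ i ∈ Finset.Icc (-(R : ℤ)) R, y i = z i} =
          ⋂ i ∈ Finset.Icc (-(R : ℤ)) R, {y | y i = z i} := by ext; simp
      rw [this]
      refine isOpen_biInter_finset fun i _ => ?_
      exact (isOpen_discrete ({z i} : Set A)).preimage (continuous_apply (A := fun _ : ℤ => A) i)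
    obtain ⟨y, hy, k, rfl⟩ := mem_closure_iff.1 hz _ hopen (by simp)
    refine ⟨k, fun i hi => ?_⟩
    exact (hy i (Finset.mem_Icc.2 (abs_le.1 hi))).symm
  · intro H
    rw [mem_closure_iff]
    intro U hU hz
    rw [isOpen_pi_iff] at hU
    obtain ⟨I, u, hu, hsub⟩ := hU z hz
    obtain ⟨k, hk⟩ := H (I.sup Int.natAbs)
    refine ⟨shiftBy k x, hsub ?_, k, rfl⟩
    intro i hi
    have : z i = x (i + k) := hk i (by
      have := Finset.le_sup (f := Int.natAbs) hi
      rw [Int.abs_eq_natAbs]; exact_mod_cast this)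
    show x (i + k) ∈ u i
    rw [← this]
    exact (hu i hi).2

lemma locality [Finite A] {X : Set (ℤ → A)} (hX : IsClosed X) (g : X → (ℤ → A))
    (hg : Continuous g) :
    ∃ N : ℕ, ∀ y y' : X, (∀ t : ℤ, |t| ≤ N → y.1 t = y'.1 t) → g y 0 = g y' 0 := by
  have : CompactSpace X := isCompact_iff_compactSpace.1 hX.isCompact
  by_contra hc
  push Not at hc
  let K : ℕ → Set (X × X) := fun N =>
    {q | (∀ t : ℤ, |t| ≤ N → q.1.1 t = q.2.1 t) ∧ g q.1 0 ≠ g q.2 0}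
  have hK : ∀ N, IsClosed (K N) := by
    intro N
    apply IsClosed.inter
    · have : {q : X × X | ∀ t : ℤ, |t| ≤ N → q.1.1 t = q.2.1 t} =
          ⋂ t : ℤ, ⋂ _ : |t| ≤ N, {q : X × X | q.1.1 t = q.2.1 t} := by ext; simp
      change IsClosed {q : X × X | ∀ t : ℤ, |t| ≤ N → q.1.1 t = q.2.1 t}
      rw [this]
      refine isClosed_iInter fun t => isClosed_iInter fun _ => isClosed_eq ?_ ?_
      · exact (continuous_apply t).comp (continuous_subtype_val.comp continuous_fst)
      · exact (continuous_apply t).comp (continuous_subtype_val.comp continuous_snd)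
    · have h1 : Continuous fun q : X × X => g q.1 0 := by fun_prop
      have h2 : Continuous fun q : X × X => g q.2 0 := by fun_prop
      exact (isClosed_discrete {p : A × A | p.1 ≠ p.2}).preimage (h1.prodMk h2)
  obtain ⟨q, hq⟩ := IsCompact.nonempty_iInter_of_sequence_nonempty_isCompact_isClosed K
    (fun N q hq => ⟨fun t ht => hq.1 t (ht.trans (by push_cast; omega)), hq.2⟩)
    (fun N => by obtain ⟨y, y', h1, h2⟩ := hc N; exact ⟨(y, y'), h1, h2⟩)
    (hK 0).isCompact hK
  rw [Set.mem_iInter] at hq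
  apply (hq 0).2
  have : q.1 = q.2 := by
    ext t
    exact (hq t.natAbs).1 t (by rw [Int.abs_eq_natAbs])
  rw [this]

/-- `z(-i)` is determined by the `N`-window of `x` at `i` -/
def Loc (N : ℕ) (x z : ℤ → A) : Prop :=
  ∀ i j : ℤ, (∀ t : ℤ, |t| ≤ N → x (i + t) = x (j + t)) → z (-i) = z (-j)


lemma Loc.mono {N M : ℕ} {x z : ℤ → A} (h : Loc N x z) (hNM : N ≤ M) : Loc M x z :=
  fun i j hij => h i j fun t ht => hij t (ht.trans (by exact_mod_cast hNM))

lemma shiftBy_mem {x y : ℤ → A} (hy : y ∈ closure (orbit x)) (k : ℤ) :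
    shiftBy k y ∈ closure (orbit x) := by
  have hc : Continuous (shiftBy k : (ℤ → A) → ℤ → A) := by
    unfold shiftBy; fun_prop
  refine map_mem_closure hc hy ?_
  rintro _ ⟨l, rfl⟩
  refine ⟨k + l, ?_⟩
  funext i
  simp only [shiftBy, add_assoc]

lemma self_mem (x : ℤ → A) : x ∈ closure (orbit x) :=
  subset_closure ⟨0, by funext i; simp [shiftBy]⟩

lemma conj_shiftBy {x : ℤ → A} (φ : closure (orbit x) → closure (orbit x))
    (hφ : ∀ (y : ℤ → A) (hy : y ∈ closure (orbit x)) (hy' : shift y ∈ closure (orbit x)),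
      (φ ⟨shift y, hy'⟩).1 = shiftInv (φ ⟨y, hy⟩).1)
    (k : ℤ) : ∀ (y : ℤ → A) (hy : y ∈ closure (orbit x)),
      (φ ⟨shiftBy k y, shiftBy_mem hy k⟩).1 = shiftBy (-k) (φ ⟨y, hy⟩).1 := by
  induction k using Int.induction_on with
  | zero =>
    intro y hy
    have : shiftBy 0 y = y := by funext i; simp [shiftBy]
    simp only [this]
    funext i; simp [shiftBy]
  | succ k ih =>
    intro y hy
    have e : shiftBy (k + 1) y = shift (shiftBy k y) := by
      funext i; simp only [shiftBy, shift]; congr 1; ring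
    have h1 : shift (shiftBy k y) ∈ closure (orbit x) := e ▸ shiftBy_mem hy (k + 1)
    have := hφ (shiftBy k y) (shiftBy_mem hy k) h1
    simp only [e]
    rw [this, ih y hy]
    funext i; simp only [shiftBy, shiftInv]; ring_nf
  | pred k ih =>
    intro y hy
    have e : shift (shiftBy (-k - 1) y) = shiftBy (-k) y := by
      funext i; simp only [shiftBy, shift]; congr 1; ring
    have h1 : shift (shiftBy (-k - 1) y) ∈ closure (orbit x) := e ▸ shiftBy_mem hy (-k)
    have := hφ (shiftBy (-k - 1) y) (shiftBy_mem hy _) h1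
    simp only [e] at this
    rw [ih y hy] at this
    funext i
    have := congrFun this (i + 1)
    simp only [shiftBy, shiftInv] at this
    rw [add_sub_cancel_right] at this
    rw [← this]
    simp only [shiftBy]; ring_nf

lemma conj_loc [Finite A] {x : ℤ → A}
    (h : ConjugateBy (closure (orbit x)) (closure (orbit x)) shift shiftInv) :
    ∃ (N : ℕ) (z : ℤ → A), z ∈ closure (orbit x) ∧ Loc N x z ∧ Loc N z x := by
  obtain ⟨φ, hφ⟩ := h
  obtain ⟨N, hN⟩ := locality isClosed_closure (fun y => (φ y).1) (by fun_prop)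
  obtain ⟨N', hN'⟩ := locality isClosed_closure (fun y => (φ.symm y).1) (by fun_prop)
  have key := conj_shiftBy φ hφ
  refine ⟨max N N', (φ ⟨x, self_mem x⟩).1, (φ ⟨x, self_mem x⟩).2,
    Loc.mono (N := N) ?_ (le_max_left _ _), Loc.mono (N := N') ?_ (le_max_right _ _)⟩
  · intro i j hij
    have h1 := congrFun (key i x (self_mem x)) 0
    have h2 := congrFun (key j x (self_mem x)) 0
    simp only [shiftBy, zero_add] at h1 h2
    rw [← h1, ← h2]
    apply hN
    intro t ht
    simp only [shiftBy]
    rw [add_comm t, add_comm t]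
    exact hij t ht
  · intro i j hij
    have h3 : ∀ k : ℤ, x (-k) = (φ.symm ⟨shiftBy k (φ ⟨x, self_mem x⟩).1,
        shiftBy_mem (φ ⟨x, self_mem x⟩).2 k⟩).1 0 := by
      intro k
      have h1 := key (-k) x (self_mem x)
      rw [neg_neg] at h1
      have h2 : φ ⟨shiftBy (-k) x, shiftBy_mem (self_mem x) _⟩ =
        ⟨shiftBy k (φ ⟨x, self_mem x⟩).1, shiftBy_mem (φ ⟨x, self_mem x⟩).2 k⟩ :=
        Subtype.ext h1
      rw [← h2, φ.symm_apply_apply]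
      simp [shiftBy]
    rw [h3, h3]
    apply hN'
    intro t ht
    simp only [shiftBy]
    rw [add_comm t, add_comm t]
    exact hij t ht

/-- extension of a local rule to a continuous map -/
lemma loc_extend [Finite A] {N : ℕ} {x z : ℤ → A} (h : Loc N x z) :
    ∃ F : (ℤ → A) → (ℤ → A), Continuous F ∧ (∀ k y, F (shiftBy k y) = shiftBy (-k) (F y)) ∧
      F x = z := by
  classical
  let win : (ℤ → A) → ℤ → (Fin (2 * N + 1) → A) := fun y i t => y (i + ((t : ℕ) : ℤ) - N)
  let code : (Fin (2 * N + 1) → A) → A := fun w =>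
    if hw : ∃ i, win x i = w then z (-hw.choose) else z 0
  have hcode : ∀ i, code (win x i) = z (-i) := by
    intro i
    have hw : ∃ j, win x j = win x i := ⟨i, rfl⟩
    simp only [code, dif_pos hw]
    apply h
    intro t ht
    have := abs_le.1 ht
    have h2 := congrFun hw.choose_spec ⟨(t + N).toNat, by omega⟩
    simp only [win] at h2
    have e : (((t + N).toNat : ℕ) : ℤ) = t + N := by omega
    rw [e] at h2
    convert h2 using 2 <;> ring
  refine ⟨fun y i => code (win y (-i)), ?_, ?_, ?_⟩
  · refine continuous_pi fun i => ?_
    have hc : Continuous code := continuous_of_discreteTopology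
    refine hc.comp ?_
    simp only [win]
    fun_prop
  · intro k y
    funext i
    simp only [shiftBy, win]
    congr 1
    funext t
    congr 1
    ring
  · funext i
    simp only [hcode, neg_neg]

lemma loc_conj [Finite A] {N : ℕ} {x z : ℤ → A} (h1 : z ∈ closure (orbit x))
    (h2 : x ∈ closure (orbit z)) (h3 : Loc N x z) (h4 : Loc N z x) :
    ConjugateBy (closure (orbit x)) (closure (orbit x)) shift shiftInv := by
  obtain ⟨F, hF, hFs, hFx⟩ := loc_extend h3
  obtain ⟨G, hG, hGs, hGx⟩ := loc_extend h4
  have maps : ∀ (F : (ℤ → A) → (ℤ → A)) (a : ℤ → A), Continuous F →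
      (∀ k y, F (shiftBy k y) = shiftBy (-k) (F y)) → F a ∈ closure (orbit x) →
      ∀ y ∈ closure (orbit a), F y ∈ closure (orbit x) := by
    intro F a hF hFs ha y hy
    have : F y ∈ closure (closure (orbit x)) := by
      refine map_mem_closure hF hy ?_
      rintro _ ⟨k, rfl⟩
      rw [hFs]
      exact shiftBy_mem ha _
    rwa [closure_closure] at this
  have hsub : closure (orbit x) ⊆ closure (orbit z) := by
    apply closure_minimal _ isClosed_closure
    rintro _ ⟨k, rfl⟩
    exact shiftBy_mem h2 k
  have hGF : Set.EqOn (G ∘ F) id (closure (orbit x)) := by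
    apply Set.EqOn.closure _ (hG.comp hF) continuous_id
    rintro _ ⟨k, rfl⟩
    simp [hFs, hGs, hFx, hGx]
  have hFG : Set.EqOn (F ∘ G) id (closure (orbit z)) := by
    apply Set.EqOn.closure _ (hF.comp hG) continuous_id
    rintro _ ⟨k, rfl⟩
    simp [hFs, hGs, hFx, hGx]
  have mF := maps F x hF hFs (hFx ▸ h1)
  have mG : ∀ y ∈ closure (orbit x), G y ∈ closure (orbit x) := fun y hy =>
    maps G z hG hGs (hGx ▸ self_mem x) y (hsub hy)
  refine ⟨{ toFun := fun y => ⟨F y.1, mF _ y.2⟩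
            invFun := fun y => ⟨G y.1, mG _ y.2⟩
            left_inv := fun y => Subtype.ext (hGF y.2)
            right_inv := fun y => Subtype.ext (hFG (hsub y.2))
            continuous_toFun := by fun_prop
            continuous_invFun := by fun_prop }, ?_⟩
  intro y hy hy'
  exact hFs 1 y

/-- recognizability of the residue mod `p` -/
lemma recog {y : ℤ → A} {p q : ℕ} (hq : 0 < q) (hpq : p ∣ q) (a b : ℤ) (hab : (p : ℤ) ∣ a - b)
    (hne : ∀ k : ℤ, y (a + k * q) ≠ y (b + k * q))
    (hc : ∀ i j : ℤ, (p : ℤ) ∣ i - j → ¬ (p : ℤ) ∣ i - a → y i = y j) :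
    ∃ N : ℕ, ∀ i j : ℤ, (∀ t : ℤ, |t| ≤ N → y (i + t) = y (j + t)) → (p : ℤ) ∣ i - j := by
  refine ⟨q + (b - a).natAbs, fun i j hij => ?_⟩
  by_contra hd
  have hqz : (0 : ℤ) < q := by exact_mod_cast hq
  obtain ⟨l, hl⟩ := hpq
  have hlz : (q : ℤ) = p * l := by exact_mod_cast hl
  set k := (i - a) / q with hk
  have h1 : 0 ≤ (i - a) % q := Int.emod_nonneg _ hqz.ne'
  have h2 : (i - a) % q < q := Int.emod_lt_of_pos _ hqz
  have h3 : (q : ℤ) * k + (i - a) % q = i - a := Int.mul_ediv_add_emod _ _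
  have e1 : a + k * q = i + (-((i - a) % q)) := by linarith
  have e2 : b + k * q = i + (-((i - a) % q) + (b - a)) := by linarith
  have w1 := hij (-((i - a) % q)) (by push_cast; rw [abs_neg, abs_of_nonneg h1]; have := abs_nonneg (b-a); omega)
  have w2 := hij (-((i - a) % q) + (b - a)) (by
    push_cast
    refine (abs_add_le _ _).trans ?_
    rw [abs_neg, abs_of_nonneg h1]; omega)
  apply hne k
  rw [e1, e2, w1, w2]
  apply hc
  · obtain ⟨c, hc'⟩ := hab
    exact ⟨c, by linarith⟩
  · intro hdvd
    apply hd
    obtain ⟨c, hc'⟩ := hdvd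
    refine ⟨k * l - c, ?_⟩
    have : (q : ℤ) * k = p * (k * l) := by rw [hlz]; ring
    rw [mul_sub, ← this, ← hc']
    linarith

lemma pal_conj [Finite A] {x : ℤ → A} {P : ℕ → ℕ} (hs : SingleHoles x P) {n : ℕ}
    {θ : Equiv.Perm A} (hpal : Pal x P n θ) :
    ConjugateBy (closure (orbit x)) (closure (orbit x)) shift shiftInv := by
  classical
  obtain ⟨h, -, -, hh⟩ := hole_exists hs n
  have hp := P_pos hs n
  -- two different letters in holes
  have hdiff : ∃ k : ℤ, x (h + k * P n) ≠ x h := by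
    by_contra hc
    push Not at hc
    exact hh hc
  obtain ⟨k, hk⟩ := hdiff
  set b := h + k * P n with hb
  have hbh : b ∉ PerSet x (P n) := (hole_iff hs hh _).2 ⟨k, by rw [hb]; ring⟩
  obtain ⟨m, hnm, hm⟩ := per_all hs (max h.natAbs b.natAbs) n
  have hhm : h ∈ PerSet x (P m) := hm h (by rw [Int.abs_eq_natAbs]; exact_mod_cast le_max_left _ _)
  have hbm : b ∈ PerSet x (P m) := hm b (by rw [Int.abs_eq_natAbs]; exact_mod_cast le_max_right _ _)
  have hpm : 0 < P m := by exact_mod_cast P_pos hs m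
  have hdv := P_dvd hs hnm.le
  have hmem : ∀ i : ℤ, ¬ (P n : ℤ) ∣ i - h → i ∈ PerSet x (P n) := by
    intro i hi
    by_contra hc
    exact hi ((hole_iff hs hh i).1 hc)
  obtain ⟨z, hz⟩ : ∃ z : ℤ → A, ∀ i, z (-i) = if (P n : ℤ) ∣ i - h then θ (x i) else x (2 * h - i) :=
    ⟨fun i => if (P n : ℤ) ∣ -i - h then θ (x (-i)) else x (2 * h - -i), fun i => by simp⟩
  have hrefl : ∀ i : ℤ, (P n : ℤ) ∣ (2 * h - i) - h ↔ (P n : ℤ) ∣ i - h := by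
    intro i
    rw [show (2 * h - i) - h = -(i - h) by ring, dvd_neg]
  -- recognizability for x
  obtain ⟨N₁, hN₁⟩ := recog (y := x) hpm hdv h b ⟨-k, by rw [hb]; ring⟩
    (fun k => by rw [hhm k, hbm k]; exact hk.symm)
    (fun i j hij hi => per_eq (hmem i hi) hij)
  have hzc : ∀ i j : ℤ, (P n : ℤ) ∣ i - j → ¬ (P n : ℤ) ∣ i - h → z (-i) = z (-j) := by
    intro i j hij hi
    have hj : ¬ (P n : ℤ) ∣ j - h := fun hj => hi (by
      have := dvd_add hij hj; rwa [sub_add_sub_cancel] at this)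
    rw [hz, hz, if_neg hi, if_neg hj]
    apply per_eq (hmem _ (by rwa [hrefl]))
    rw [show 2 * h - i - (2 * h - j) = -(i - j) by ring, dvd_neg]
    exact hij
  have hdivk : ∀ k : ℤ, (P n : ℤ) ∣ k * P m := fun k =>
    Dvd.dvd.mul_left (by exact_mod_cast hdv) k
  obtain ⟨N₂, hN₂⟩ := recog (y := z) (p := P n) (q := P m) hpm hdv (-h) (-b)
    ⟨k, by rw [hb]; ring⟩
    (fun l => by
      have e1 : -h + l * P m = -(h + -l * P m) := by ring
      have e2 : -b + l * P m = -(b + -l * P m) := by ring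
      rw [e1, e2, hz, hz, if_pos, if_pos, hhm (-l), hbm (-l)]
      · exact fun he => hk (θ.injective he).symm
      · rw [show b + -l * P m - h = k * P n + -l * P m by rw [hb]; ring]
        exact dvd_add (dvd_mul_left _ _) (hdivk _)
      · rw [add_sub_cancel_left]; exact hdivk _)
    (fun i j hij hi => by
      have := hzc (-i) (-j) (by
        rw [show -i - -j = -(i - j) by ring, dvd_neg]; exact hij) (by
        rw [show -i - h = -(i - -h) by ring, dvd_neg]; exact hi)
      simpa using this)
  -- copies
  have hcopy : ∀ m, n < m → ∀ g, g ∉ PerSet x (P m) → ∀ i : ℤ, g < i → i < g + P m →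
      z (-i) = x (2 * g + P m - i) := by
    intro m hm g hg i hi1 hi2
    have hgn := (hole_iff hs hh g).1 (hole_nest hs hm.le hg)
    have hdm : (P n : ℤ) ∣ P m := by exact_mod_cast P_dvd hs hm.le
    rw [hz]
    split_ifs with hi
    · have := hpal m hm g hg (i - g) (by linarith) (by linarith) (by
        have := dvd_sub hi hgn; rwa [sub_sub_sub_cancel_right] at this)
      rw [add_sub_cancel] at this
      rw [this]
      congr 1; ring
    · apply per_eq (hmem _ (by rwa [hrefl]))
      rw [show 2 * h - i - (2 * g + P m - i) = -(2 * (g - h) + P m) by ring, dvd_neg]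
      exact dvd_add (Dvd.dvd.mul_left hgn 2) hdm
  refine loc_conj (N := max N₁ N₂) (z := z) ?_ ?_ (Loc.mono (N := N₁) ?_ (le_max_left _ _))
    (Loc.mono (N := N₂ ) ?_ (le_max_right _ _))
  · rw [mem_closure_orbit]
    intro R
    obtain ⟨m, g, hm, hg, hw⟩ := window_hole hs R n
    refine ⟨2 * g + P m, fun i hi => ?_⟩
    obtain ⟨h1, h2⟩ := hw (-i) (by rwa [abs_neg])
    have := hcopy m hm g hg (-i) h1 h2
    rw [neg_neg] at this
    rw [this]; congr 1; ring
  · rw [mem_closure_orbit]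
    intro R
    obtain ⟨m, g, hm, hg, hw⟩ := window_hole hs R n
    refine ⟨-(2 * g + P m), fun i hi => ?_⟩
    obtain ⟨h1, h2⟩ := hw i hi
    have := hcopy m hm g hg (2 * g + P m - i) (by linarith) (by linarith)
    rw [show i + -(2 * g + P m) = -(2 * g + P m - i) by ring, this]
    congr 1; ring
  · intro i j hij
    have hd := hN₁ i j hij
    by_cases hi : (P n : ℤ) ∣ i - h
    · have hj : (P n : ℤ) ∣ j - h := by
        have := dvd_sub hi hd; rwa [sub_sub_sub_cancel_left] at this
      rw [hz, hz, if_pos hi, if_pos hj]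
      have := hij 0 (by simp)
      simp only [add_zero] at this
      rw [this]
    · exact hzc i j hd hi
  · intro i j hij
    have hd := hN₂ i j hij
    have hd' : (P n : ℤ) ∣ -i - -j := by
      rw [show -i - -j = -(i - j) by ring, dvd_neg]; exact hd
    by_cases hi : (P n : ℤ) ∣ -i - h
    · have hj : (P n : ℤ) ∣ -j - h := by
        have := dvd_sub hi hd'; rwa [sub_sub_sub_cancel_left] at this
      have h0 := hij 0 (by simp)
      simp only [add_zero] at h0
      have h1 := hz (-i)
      have h2 := hz (-j)
      rw [if_pos hi, neg_neg] at h1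
      rw [if_pos hj, neg_neg] at h2
      apply θ.injective
      rw [← h1, ← h2, h0]
    · exact (per_eq (hmem _ hi) hd' : x (-i) = x (-j))

/-- a point of the subshift copies the skeleton of `x` -/
lemma skel_copy {x z : ℤ → A} {p : ℕ} (hp : 0 < p) (hz : z ∈ closure (orbit x)) :
    ∃ c : ℤ, ∀ i, i + c ∈ PerSet x p → z i = x (i + c) := by
  let K : Set (ℤ → A) := ⋃ c ∈ Finset.range p, {y | ∀ i, i + (c : ℤ) ∈ PerSet x p → y i = x (i + c)}
  have hK : IsClosed K := by
    refine isClosed_biUnion_finset fun c _ => ?_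
    have : {y : ℤ → A | ∀ i, i + (c : ℤ) ∈ PerSet x p → y i = x (i + c)} =
      ⋂ i : ℤ, ⋂ _ : i + (c : ℤ) ∈ PerSet x p, {y | y i = x (i + c)} := by ext; simp
    rw [this]
    exact isClosed_iInter fun i => isClosed_iInter fun _ =>
      isClosed_eq (continuous_apply i) continuous_const
  have hsub : closure (orbit x) ⊆ K := by
    apply closure_minimal _ hK
    rintro _ ⟨k, rfl⟩
    have hpz : (0 : ℤ) < p := by exact_mod_cast hp
    have h0 := Int.emod_nonneg k hpz.ne'
    have h1 := Int.emod_lt_of_pos k hpz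
    simp only [K, Set.mem_iUnion]
    refine ⟨(k % p).toNat, Finset.mem_range.2 (by omega), fun i hi => ?_⟩
    rw [Int.toNat_of_nonneg h0] at hi ⊢
    symm
    apply per_eq hi
    rw [add_sub_add_left_eq_sub]
    rw [dvd_sub_comm]; exact Int.dvd_self_sub_emod
  have := hsub hz
  simp only [K, Set.mem_iUnion] at this
  obtain ⟨c, -, hc⟩ := this
  exact ⟨c, hc⟩

lemma str {x z : ℤ → A} {P : ℕ → ℕ} (hs : SingleHoles x P) (hz : z ∈ closure (orbit x))
    {N : ℕ} (h1 : Loc N x z) (h2 : Loc N z x) (m : ℕ) :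
    ∃ t : ℤ, |t| ≤ N ∧ (∀ g, g ∉ PerSet x (P m) → ∀ i, t - i ∈ PerSet x (P m) →
      z i = x (i + 2 * g - t) ∧ i + 2 * g - t ∈ PerSet x (P m)) ∧
      ∃ i₁ i₂ : ℤ, (P m : ℤ) ∣ i₁ - i₂ ∧ z i₁ ≠ z i₂ ∧ t - i₁ ∉ PerSet x (P m) := by
  have hpm := P_pos hs m
  obtain ⟨c, hc⟩ := skel_copy (p := P m) (by exact_mod_cast hpm) hz
  -- z is not periodic
  have hnp : ∃ i₁ i₂ : ℤ, (P m : ℤ) ∣ i₁ - i₂ ∧ z i₁ ≠ z i₂ := by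
    by_contra hcon
    push Not at hcon
    obtain ⟨h, -, -, hh⟩ := hole_exists hs m
    apply hh
    intro k
    have := h2 (-(h + k * P m)) (-h) (fun t _ => hcon _ _ ⟨-k, by ring⟩)
    simpa using this
  obtain ⟨i₁, i₂, hd, hne⟩ := hnp
  have hi1 : i₁ + c ∉ PerSet x (P m) := by
    intro hi
    apply hne
    have hi2 : i₂ + c ∈ PerSet x (P m) := per_congr (by simpa using hd) hi
    rw [hc _ hi, hc _ hi2]
    exact per_eq hi (by simpa using hd)
  have : ∃ t : ℤ, |t| ≤ N ∧ x (-i₁ + t) ≠ x (-i₂ + t) := by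
    by_contra hcon
    push Not at hcon
    have := h1 (-i₁) (-i₂) hcon
    rw [neg_neg, neg_neg] at this
    exact hne this
  obtain ⟨t, ht, htne⟩ := this
  have hd' : (P m : ℤ) ∣ (-i₁ + t) - (-i₂ + t) := by
    rw [show (-i₁ + t) - (-i₂ + t) = -(i₁ - i₂) by ring, dvd_neg]; exact hd
  have hti : t - i₁ ∉ PerSet x (P m) := by
    intro hcon
    rw [sub_eq_neg_add] at hcon
    exact htne (per_eq hcon hd')
  refine ⟨t, ht, ?_, i₁, i₂, hd, hne, hti⟩
  intro g hg i hi
  have d1 := (hole_iff hs hg _).1 hi1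
  have d2 := (hole_iff hs hg _).1 hti
  have hic : i + c ∈ PerSet x (P m) := by
    by_contra hcon
    have d3 := (hole_iff hs hg _).1 hcon
    refine ((hole_iff hs hg (t - i)).2 ?_) hi
    have := dvd_sub (dvd_add d1 d2) d3
    rwa [show i₁ + c - g + (t - i₁ - g) - (i + c - g) = t - i - g by ring] at this
  have d4 : (P m : ℤ) ∣ i + c - (i + 2 * g - t) := by
    have := dvd_add d1 d2
    rwa [show i₁ + c - g + (t - i₁ - g) = i + c - (i + 2 * g - t) by ring] at this
  exact ⟨by rw [hc i hic]; exact per_eq hic d4, per_congr d4 hic⟩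

lemma conj_pal [Finite A] {x : ℤ → A} {P : ℕ → ℕ} (hs : SingleHoles x P)
    (h : ConjugateBy (closure (orbit x)) (closure (orbit x)) shift shiftInv) :
    ∃ (n : ℕ) (θ : Equiv.Perm A), Pal x P n θ := by
  classical
  obtain ⟨N, z, hz, h1, h2⟩ := conj_loc h
  choose T hTN hT1 hT2 using str hs hz h1 h2
  let n := 2 * N + 1
  have hn : 2 * (N : ℤ) < P n := by
    have : n ≤ P n := hs.1.1.le_apply
    omega
  obtain ⟨g, -, -, hg⟩ := hole_exists hs n
  have hTeq : ∀ m, n ≤ m → T m = T n := by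
    intro m hm
    obtain ⟨i₁, i₂, hd, hne, hi⟩ := hT2 m
    have hdn : (P n : ℤ) ∣ i₁ - i₂ := (by exact_mod_cast P_dvd hs hm : (P n : ℤ) ∣ P m).trans hd
    have hi1 : T n - i₁ ∉ PerSet x (P n) := by
      intro hcon
      have hi2 : T n - i₂ ∈ PerSet x (P n) := per_congr (by
        rw [show T n - i₁ - (T n - i₂) = -(i₁ - i₂) by ring, dvd_neg]; exact hdn) hcon
      obtain ⟨e1, e2⟩ := hT1 n g hg _ hcon
      obtain ⟨e3, e4⟩ := hT1 n g hg _ hi2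
      apply hne
      rw [e1, e3]
      apply per_eq e2
      rwa [show i₁ + 2 * g - T n - (i₂ + 2 * g - T n) = i₁ - i₂ by ring]
    have := (hole_iff hs (hole_nest hs hm hi) _).1 hi1
    rw [sub_sub_sub_cancel_right] at this
    have b1 := abs_le.1 (hTN n)
    have b2 := abs_le.1 (hTN m)
    have := Int.eq_zero_of_abs_lt_dvd this (abs_lt.2 ⟨by omega, by omega⟩)
    omega
  set s := T n with hsdef
  have hsN := abs_le.1 (hTN n)
  rw [← hsdef] at hsN
  have hth : ∀ i j : ℤ, i ∉ PerSet x (P n) → j ∉ PerSet x (P n) →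
      (x i = x j ↔ z (s - i) = z (s - j)) := by
    intro i j hi hj
    have hij := (hole_iff hs hj i).1 hi
    constructor
    · intro he
      have := h1 (i - s) (j - s) (fun t ht => by
        have ht' := abs_le.1 ht
        by_cases hts : t = s
        · subst hts; simpa using he
        · have hb := between hs hi (r := t - s) (by omega) (abs_lt.2 ⟨by omega, by omega⟩)
          rw [show i - s + t = i + (t - s) by ring, show j - s + t = j + (t - s) by ring]
          exact per_eq hb (by simpa using hij))
      simpa using this
    · intro he
      have := h2 (-i) (-j) (fun t ht => by
        have ht' := abs_le.1 ht
        by_cases hts : t = s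
        · subst hts
          rw [neg_add_eq_sub, neg_add_eq_sub]; exact he
        · have hb := between hs hi (r := s - t) (by omega) (abs_lt.2 ⟨by omega, by omega⟩)
          have hb' := between hs hj (r := s - t) (by omega) (abs_lt.2 ⟨by omega, by omega⟩)
          obtain ⟨e1, e2⟩ := hT1 n g hg (-i + t) (by
            rw [← hsdef, show s - (-i + t) = i + (s - t) by ring]; exact hb)
          obtain ⟨e3, e4⟩ := hT1 n g hg (-j + t) (by
            rw [← hsdef, show s - (-j + t) = j + (s - t) by ring]; exact hb')
          rw [e1, e3]
          apply per_eq e2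
          rw [show -i + t + 2 * g - T n - (-j + t + 2 * g - T n) = -(i - j) by ring, dvd_neg]
          exact hij)
      simpa using this
  -- the permutation
  let B : Set A := {a | ∃ i, i ∉ PerSet x (P n) ∧ x i = a}
  let f : B → A := fun a => z (s - a.2.choose)
  have hf : ∀ i (hi : i ∉ PerSet x (P n)), f ⟨x i, i, hi, rfl⟩ = z (s - i) := by
    intro i hi
    have hw : ∃ j, j ∉ PerSet x (P n) ∧ x j = x i := ⟨i, hi, rfl⟩
    exact (hth _ _ hw.choose_spec.1 hi).1 hw.choose_spec.2
  have hinj : Function.Injective f := by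
    rintro ⟨_, i, hi, rfl⟩ ⟨_, j, hj, rfl⟩ he
    rw [hf i hi, hf j hj] at he
    exact Subtype.ext ((hth i j hi hj).2 he)
  obtain ⟨θ, hθ⟩ : ∃ θ : Equiv.Perm A, ∀ i, i ∉ PerSet x (P n) → θ (x i) = z (s - i) := by
    have := Fintype.ofFinite A
    let e : {a // a ∈ B} ≃ {a // a ∈ Set.range f} := Equiv.ofInjective f hinj
    refine ⟨e.extendSubtype, fun i hi => ?_⟩
    rw [Equiv.extendSubtype_apply_of_mem e (x i) ⟨i, hi, rfl⟩]
    exact hf i hi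
  refine ⟨n, θ, fun m hm g hg r hr0 hr1 hr => ?_⟩
  have hgr : g + r ∉ PerSet x (P n) := (hole_iff hs (hole_nest hs hm.le hg) _).2 (by simpa using hr)
  rw [hθ _ hgr]
  have hb := between hs hg (r := r) hr0.ne' (by rwa [abs_of_pos hr0])
  have hms := hTeq m hm.le
  obtain ⟨e1, e2⟩ := hT1 m g hg (s - (g + r)) (by rw [hms, sub_sub_cancel]; exact hb)
  rw [e1]
  apply per_eq e2
  rw [hms]
  exact ⟨-1, by ring⟩

end Top
end Proof18

/-- Let `x` be a Toeplitz sequence with single holes with respect to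
the period structure `P`, generating the Toeplitz subshift `X`. Then `(X, S)` is
conjugate to `(X, S⁻¹)` iff there are `n` and a permutation `θ` of `A` such that the
`(n, m)`-filling of `x` is a `θ`-palindrome for every `m > n`. -/
theorem statement18 {A : Type*} [Fintype A] [TopologicalSpace A] [DiscreteTopology A]
    (x : ℤ → A) (hx : IsToeplitz x) (P : ℕ → ℕ) (hsh : SingleHoles x P) :
    ConjugateBy (closure (orbit x)) (closure (orbit x)) shift shiftInv ↔
      ∃ (n : ℕ) (θ : Equiv.Perm A), ∀ m : ℕ, n < m →
        ∀ w : List A, IsFilling x (P n) (P m) w → ThetaPalindrome θ w := by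
  constructor
  · intro h
    obtain ⟨n, θ, hp⟩ := conj_pal hsh h
    exact ⟨n, θ, (pal_iff hsh n θ).1 hp⟩
  · rintro ⟨n, θ, hp⟩
    exact pal_conj hsh ((pal_iff hsh n θ).2 hp)

end ToeplitzFR
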